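/- arXiv:1902.06101 — 7 statements merged into one kernel-verified Lean document; each statement's English description precedes it below -/
import Mathlib

section
/- Let β > 0, ω > 0, t ∈ ℝ with t ≠ 0, and suppose X lies in the interior intersection (0, ω) ∩ (t, t+ω). Then the ratio bound is strict: e^{-β|t|} · ∫_{t}^{t+ω} e^{-β|X−y|} dy < ∫_{0}^{ω} e^{-β|X−y|} dy < e^{β|t|} · ∫_{t}^{t+ω} e^{-β|X−y|} dy; in particular | log(∫_{0}^{ω} e^{-β|X−y|} dy) − log(∫_{t}^{t+ω} e^{-β|X−y|} dy) | < β|t|. -/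
/-- Translating the integration interval changes the integral of a Laplace kernel by a factor
strictly less than `exp (β * |b - a|)` when the kernel is centred inside the initial interval. -/
theorem integral_exp_neg_mul_abs_sub_lt {β ω a b X : ℝ} (hβ : 0 < β) (hab : a ≠ b)
    (hX : X ∈ Set.Ioo a (a + ω)) :
    (∫ y in a..(a + ω), Real.exp (-(β * |X - y|))) <
      Real.exp (β * |b - a|) * ∫ y in b..(b + ω), Real.exp (-(β * |X - y|)) := by
  obtain ⟨haX, hXω⟩ := hX
  have hshift : (∫ y in b..(b + ω), Real.exp (-(β * |X - y|))) =
      ∫ y in a..(a + ω), Real.exp (-(β * |X - (y + (b - a))|)) := by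
    rw [intervalIntegral.integral_comp_add_right (fun y => Real.exp (-(β * |X - y|)))]
    congr 1 <;> ring
  rw [hshift, ← intervalIntegral.integral_const_mul]
  simp only [← Real.exp_add]
  apply intervalIntegral.integral_lt_integral_of_continuousOn_of_le_of_exists_lt
  · linarith
  · fun_prop
  · fun_prop
  · intro y _
    apply Real.exp_le_exp.mpr
    have h : |X - (y + (b - a))| ≤ |X - y| + |b - a| := by
      rw [← sub_sub]
      exact abs_sub _ _
    nlinarith
  · obtain ⟨y, hy, h⟩ : ∃ y ∈ Set.Icc a (a + ω), |X - (y + (b - a))| < |X - y| + |b - a| := by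
      rcases lt_or_gt_of_ne hab with hlt | hlt
      · refine ⟨(a + X) / 2, ⟨by linarith, by linarith⟩, ?_⟩
        rw [abs_of_pos (a := b - a) (by linarith), abs_of_pos (a := X - (a + X) / 2) (by linarith),
          abs_lt]
        constructor <;> linarith
      · refine ⟨(X + (a + ω)) / 2, ⟨by linarith, by linarith⟩, ?_⟩
        rw [abs_of_neg (a := b - a) (by linarith),
          abs_of_neg (a := X - (X + (a + ω)) / 2) (by linarith), abs_lt]
        constructor <;> linarith
    refine ⟨y, hy, Real.exp_lt_exp.mpr ?_⟩
    nlinarith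


/- STATEMENT 1: β > 0, ω > 0, t ≠ 0, X ∈ (0, ω) ∩ (t, t+ω). Then
   e^{-β|t|} · ∫_{t}^{t+ω} e^{-β|X−y|} dy < ∫_{0}^{ω} e^{-β|X−y|} dy
     < e^{β|t|} · ∫_{t}^{t+ω} e^{-β|X−y|} dy,
   and in particular
   |log ∫_{0}^{ω} e^{-β|X−y|} dy − log ∫_{t}^{t+ω} e^{-β|X−y|} dy| < β|t|. -/
theorem stmt_1 (β ω t X : ℝ) (hβ : 0 < β) (hω : 0 < ω) (ht : t ≠ 0)
    (hX : X ∈ Set.Ioo (0:ℝ) ω ∩ Set.Ioo t (t + ω)) :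
    Real.exp (-(β * |t|)) * (∫ y in t..(t + ω), Real.exp (-(β * |X - y|))) <
        (∫ y in (0:ℝ)..ω, Real.exp (-(β * |X - y|))) ∧
      (∫ y in (0:ℝ)..ω, Real.exp (-(β * |X - y|))) <
        Real.exp (β * |t|) * (∫ y in t..(t + ω), Real.exp (-(β * |X - y|))) ∧
      |Real.log (∫ y in (0:ℝ)..ω, Real.exp (-(β * |X - y|))) -
          Real.log (∫ y in t..(t + ω), Real.exp (-(β * |X - y|)))| < β * |t| := by
  have hpos (a : ℝ) : 0 < ∫ y in a..(a + ω), Real.exp (-(β * |X - y|)) :=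
    intervalIntegral.intervalIntegral_pos_of_pos
      (Continuous.intervalIntegrable (by fun_prop) _ _) (fun _ => Real.exp_pos _) (by linarith)
  have hupper := integral_exp_neg_mul_abs_sub_lt (ω := ω) hβ ht.symm (by simpa using hX.1)
  have hlower := integral_exp_neg_mul_abs_sub_lt (ω := ω) hβ ht hX.2
  have hI := hpos 0
  have hJ := hpos t
  simp only [zero_add, sub_zero, zero_sub, abs_neg] at hupper hlower hI
  refine ⟨?_, hupper, ?_⟩
  · rwa [Real.exp_neg, inv_mul_lt_iff₀ (Real.exp_pos _)]
  · have hlog_upper := Real.log_lt_log hI hupper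
    have hlog_lower := Real.log_lt_log hJ hlower
    rw [Real.log_mul (Real.exp_ne_zero _) hJ.ne', Real.log_exp] at hlog_upper
    rw [Real.log_mul (Real.exp_ne_zero _) hI.ne', Real.log_exp] at hlog_lower
    rw [abs_lt]
    constructor <;> linarith
end

section
/- Let β > 0, ω > 0 and let t, X be real numbers with 0 ≤ t ≤ X ≤ ω. Then e^{-βt} · (2 − e^{-β(X−t)} − e^{-β(ω+t−X)}) ≤ 2 − e^{-βX} − e^{-β(ω−X)} ≤ e^{βt} · (2 − e^{-β(X−t)} − e^{-β(ω+t−X)}). -/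
/-- For `a, s ≤ 1` with `0 ≤ s`, the factor `a * (1 + s)` is at most `2`. -/
lemma mul_one_sub_sq_le_two_mul_one_sub {a s : ℝ} (ha : a ≤ 1) (hs0 : 0 ≤ s) (hs1 : s ≤ 1) :
    a * (1 - s ^ 2) ≤ 2 * (1 - s) := by
  have h : a * (1 + s) ≤ 2 := by nlinarith
  nlinarith [mul_le_mul_of_nonneg_right h (sub_nonneg.2 hs1)]

/- STATEMENT 3: β > 0, ω > 0, 0 ≤ t ≤ X ≤ ω. Then
   e^{-βt}·(2 − e^{-β(X−t)} − e^{-β(ω+t−X)}) ≤ 2 − e^{-βX} − e^{-β(ω−X)}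
     ≤ e^{βt}·(2 − e^{-β(X−t)} − e^{-β(ω+t−X)}). -/
theorem stmt_3 (β ω t X : ℝ) (hβ : 0 < β) (hω : 0 < ω)
    (ht0 : 0 ≤ t) (htX : t ≤ X) (hXω : X ≤ ω) :
    Real.exp (-(β * t)) *
        (2 - Real.exp (-(β * (X - t))) - Real.exp (-(β * (ω + t - X)))) ≤
      2 - Real.exp (-(β * X)) - Real.exp (-(β * (ω - X))) ∧
    2 - Real.exp (-(β * X)) - Real.exp (-(β * (ω - X))) ≤
      Real.exp (β * t) *
        (2 - Real.exp (-(β * (X - t))) - Real.exp (-(β * (ω + t - X)))) := by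
  have hX : Real.exp (-(β * X)) = Real.exp (-(β * (X - t))) * Real.exp (-(β * t)) := by
    rw [← Real.exp_add]; ring_nf
  have hω' : Real.exp (-(β * (ω + t - X))) =
      Real.exp (-(β * (ω - X))) * Real.exp (-(β * t)) := by
    rw [← Real.exp_add]; ring_nf
  have hinv : Real.exp (β * t) = (Real.exp (-(β * t)))⁻¹ := by
    rw [← Real.exp_neg, neg_neg]
  have hs1 : Real.exp (-(β * t)) ≤ 1 :=
    Real.exp_le_one_iff.2 (neg_nonpos.2 (mul_nonneg hβ.le ht0))
  have hp1 : Real.exp (-(β * (X - t))) ≤ 1 :=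
    Real.exp_le_one_iff.2 (neg_nonpos.2 (mul_nonneg hβ.le (sub_nonneg.2 htX)))
  have hq1 : Real.exp (-(β * (ω - X))) ≤ 1 :=
    Real.exp_le_one_iff.2 (neg_nonpos.2 (mul_nonneg hβ.le (sub_nonneg.2 hXω)))
  have hs0 : 0 < Real.exp (-(β * t)) := Real.exp_pos _
  have hp := mul_one_sub_sq_le_two_mul_one_sub hp1 hs0.le hs1
  have hq := mul_one_sub_sq_le_two_mul_one_sub hq1 hs0.le hs1
  rw [hX, hω', hinv]
  constructor
  · linarith
  · rw [le_inv_mul_iff₀ hs0]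
    linarith
end

section
/- Fix β > 0, ω > 0 and x ∈ ℝ, and define h(t) = ∫_{t}^{t+ω} e^{-β|x−y|} dy for t ∈ ℝ. Then h(t) depends on t only through the distance |x − t − ω/2| of x to the midpoint of the interval [t, t+ω], and h is nonincreasing in that distance: for all t₁, t₂ ∈ ℝ, if |x − t₁ − ω/2| ≤ |x − t₂ − ω/2| then h(t₁) ≥ h(t₂). -/
/-- The integral of an even function over a symmetric window about `|s|` equals that about `s`. -/
theorem intervalIntegral_window_abs {g : ℝ → ℝ} (hg : ∀ a, g (-a) = g a) (w s : ℝ) :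
    ∫ u in (|s| - w)..(|s| + w), g u = ∫ u in (s - w)..(s + w), g u := by
  rcases abs_choice s with h | h
  · rw [h]
  · have key := intervalIntegral.integral_comp_neg (a := s - w) (b := s + w) g
    simp only [hg] at key
    rw [h, key]
    congr 1 <;> ring

/-- For a continuous function that is nonincreasing in `|u|`, the integral over a window of
half-width `w` is nonincreasing in the distance of the midpoint from the origin. -/
theorem intervalIntegral_window_le_of_abs_le {g : ℝ → ℝ} (hc : Continuous g)
    (hg : ∀ a b, |a| ≤ |b| → g b ≤ g a) {w : ℝ} (hw : 0 ≤ w) {s₁ s₂ : ℝ} (hs : |s₁| ≤ |s₂|) :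
    ∫ u in (s₂ - w)..(s₂ + w), g u ≤ ∫ u in (s₁ - w)..(s₁ + w), g u := by
  have heven : ∀ a, g (-a) = g a := fun a =>
    le_antisymm (hg _ _ (abs_neg a).ge) (hg _ _ (abs_neg a).le)
  rw [← intervalIntegral_window_abs heven w s₁, ← intervalIntegral_window_abs heven w s₂]
  have hi : ∀ a b, IntervalIntegrable g MeasureTheory.volume a b := hc.intervalIntegrable
  have hshift : ∫ u in (|s₁| + w)..(|s₂| + w), g u ≤ ∫ u in (|s₁| - w)..(|s₂| - w), g u := by
    rw [← intervalIntegral.integral_comp_add_right g w,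
      ← intervalIntegral.integral_comp_sub_right g w]
    refine intervalIntegral.integral_mono_on hs
      ((hc.comp (continuous_add_const w)).intervalIntegrable _ _)
      ((hc.comp (continuous_sub_right w)).intervalIntegrable _ _) fun u hu => hg _ _ ?_
    have hu₀ : 0 ≤ u := (abs_nonneg s₁).trans hu.1
    rw [abs_of_nonneg (add_nonneg hu₀ hw), abs_le]
    constructor <;> linarith
  have h₁ := intervalIntegral.integral_add_adjacent_intervals
    (hi (|s₁| - w) (|s₁| + w)) (hi (|s₁| + w) (|s₂| + w))
  have h₂ := intervalIntegral.integral_add_adjacent_intervals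
    (hi (|s₁| - w) (|s₂| - w)) (hi (|s₂| - w) (|s₂| + w))
  linarith

/- STATEMENT 5: Fix β > 0, ω > 0, x ∈ ℝ and let h(t) = ∫_{t}^{t+ω} e^{-β|x−y|} dy.
   Then h depends on t only through |x − t − ω/2| (the distance of x to the midpoint
   of [t, t+ω]) and is nonincreasing in that distance: if
   |x − t₁ − ω/2| ≤ |x − t₂ − ω/2| then h(t₁) ≥ h(t₂). -/
theorem stmt_5 (β ω x : ℝ) (hβ : 0 < β) (hω : 0 < ω) :
    (∀ t₁ t₂ : ℝ, |x - t₁ - ω / 2| = |x - t₂ - ω / 2| →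
      (∫ y in t₁..(t₁ + ω), Real.exp (-(β * |x - y|))) =
        (∫ y in t₂..(t₂ + ω), Real.exp (-(β * |x - y|)))) ∧
    (∀ t₁ t₂ : ℝ, |x - t₁ - ω / 2| ≤ |x - t₂ - ω / 2| →
      (∫ y in t₁..(t₁ + ω), Real.exp (-(β * |x - y|))) ≥
        (∫ y in t₂..(t₂ + ω), Real.exp (-(β * |x - y|)))) := by
  have key : ∀ t₁ t₂ : ℝ, |x - t₁ - ω / 2| ≤ |x - t₂ - ω / 2| →
      (∫ y in t₂..(t₂ + ω), Real.exp (-(β * |x - y|))) ≤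
        (∫ y in t₁..(t₁ + ω), Real.exp (-(β * |x - y|))) := by
    intro t₁ t₂ h
    have hwin : ∀ t : ℝ, (∫ y in t..(t + ω), Real.exp (-(β * |x - y|))) =
        ∫ u in (x - t - ω / 2 - ω / 2)..(x - t - ω / 2 + ω / 2), Real.exp (-(β * |u|)) := by
      intro t
      rw [intervalIntegral.integral_comp_sub_left (fun u => Real.exp (-(β * |u|))) x]
      congr 1 <;> ring
    rw [hwin, hwin]
    refine intervalIntegral_window_le_of_abs_le (by fun_prop) (fun a b hab => ?_) (by positivity) h
    gcongr
  exact ⟨fun t₁ t₂ h => le_antisymm (key t₂ t₁ h.ge) (key t₁ t₂ h.le), key⟩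
end

section
/- In the decentralized ADMM setting, suppose at iteration k+1 each x_i^{k+1} satisfies the first-order optimality condition ∇f_i(x_i^{k+1}) = A_iᵀ(λ^k − ρ_i^{k+1}(A_i x_i^{k+1} + Σ_{j≠i} A_j x_j^k − c)) + Γ_i^{k+1}(x_i^k − x_i^{k+1}), and λ^{k+1} = λ^k − ζ(Σ_i A_i x_i^{k+1} − c). Assume there exist α > 0 and ρ⁰ > 0 such that for every i: α < 2m_i / (N(ρ_{i,max}^{k+1})²σ_{i,max}² + (ρ̆_{i,max}^{k+1})²σ_{i,max}²), D_i > max{ρ_{i,max}^{k+1}σ_{i,max}², Nσ_{i,max}²/α}, ρ⁰ > N/(2α), and 0 < ζ < 2ρ⁰ − N/α. Then, writing u^k = (x_1^k, …, x_N^k, λ^k) and u* = (x*_1, …, x*_N, λ*), the contraction ‖u^k − u*‖²_G ≥ (1+p)‖u^{k+1} − u*‖²_G holds with p = min over i of the three quantities: (2m_i − αN(ρ_{i,max}^{k+1})²σ_{i,max}² − α(ρ̆_{i,max}^{k+1})²σ_{i,max}²)/(5M_i/(ζNσ_{i,min}²) + D_i), (D_i − Nσ_{i,max}²/α)/(5D_i²/(ζNσ_{i,min}²)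 + (5σ_{i,max}²/ζ)Σ_j (ρ_{j,max}^{k+1})²σ_{j,max}²/σ_{j,min}²), and (2ρ⁰/ζ − N/(αζ) − 1)/(5Σ_i ((ρ_{i,max}^{k+1})²/ζ² + 1/N)σ_{i,max}²/σ_{i,min}²); in particular p > 0, so the iteration converges linearly to u* in the G-norm. -/
open scoped InnerProductSpace BigOperators

/-- The positive-definite diagonal matrix with diagonal `ρ`, acting on Euclidean space. -/
noncomputable def diagOp {ι : Type*} [Fintype ι] (ρ : ι → ℝ)
    (v : EuclideanSpace ℝ ι) : EuclideanSpace ℝ ι :=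
  (WithLp.equiv 2 _).symm fun l => ρ l * (WithLp.equiv 2 _ v) l

theorem diagOp_apply {ι : Type*} [Fintype ι] (ρ : ι → ℝ) (v : EuclideanSpace ℝ ι) (l : ι) :
    diagOp ρ v l = ρ l * v l := rfl

theorem diagOp_add {ι : Type*} [Fintype ι] (ρ : ι → ℝ) (v w : EuclideanSpace ℝ ι) :
    diagOp ρ (v + w) = diagOp ρ v + diagOp ρ w := by
  ext l
  simp [diagOp_apply, mul_add]

theorem diagOp_sub {ι : Type*} [Fintype ι] (ρ : ι → ℝ) (v w : EuclideanSpace ℝ ι) :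
    diagOp ρ (v - w) = diagOp ρ v - diagOp ρ w := by
  ext l
  simp [diagOp_apply, mul_sub]

theorem diagOp_sub_const {ι : Type*} [Fintype ι] (ρ : ι → ℝ) (a : ℝ) (v : EuclideanSpace ℝ ι) :
    diagOp (fun l => ρ l - a) v = diagOp ρ v - a • v := by
  ext l
  simp [diagOp_apply, sub_mul]

theorem norm_diagOp_le {ι : Type*} [Fintype ι] {ρ : ι → ℝ} {b : ℝ} (hb : 0 ≤ b)
    (h : ∀ l, |ρ l| ≤ b) (v : EuclideanSpace ℝ ι) : ‖diagOp ρ v‖ ≤ b * ‖v‖ := by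
  refine le_of_sq_le_sq ?_ (by positivity)
  rw [mul_pow, EuclideanSpace.norm_sq_eq, EuclideanSpace.norm_sq_eq, Finset.mul_sum]
  refine Finset.sum_le_sum fun l _ => ?_
  rw [diagOp_apply, norm_mul, mul_pow, Real.norm_eq_abs (ρ l)]
  gcongr
  exact h l

/-- A scaled Young inequality for inner products of vectors with bounded norms. -/
theorem neg_young_le_two_inner {E : Type*} [NormedAddCommGroup E] [InnerProductSpace ℝ E]
    {a b : E} {σ β x y t : ℝ} (ht : 0 < t) (ha : ‖a‖ ≤ σ * x) (hb : ‖b‖ ≤ β * y) :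
    -(t * β ^ 2 * σ ^ 2 * x ^ 2 + y ^ 2 / t) ≤ 2 * ⟪a, b⟫_ℝ := by
  have h1 : -(‖a‖ * ‖b‖) ≤ ⟪a, b⟫_ℝ := (abs_le.mp (abs_real_inner_le_norm a b)).1
  have h2 : ‖a‖ * ‖b‖ ≤ (σ * x) * (β * y) :=
    mul_le_mul ha hb (norm_nonneg _) ((norm_nonneg _).trans ha)
  have h3 : t * β ^ 2 * σ ^ 2 * x ^ 2 + y ^ 2 / t - 2 * ((σ * x) * (β * y))
      = (t * (β * σ * x) - y) ^ 2 / t := by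
    field_simp
    ring
  have h4 : 0 ≤ (t * (β * σ * x) - y) ^ 2 / t := by positivity
  linarith

theorem norm_sum_sq_le_card_mul {ι E : Type*} [Fintype ι] [SeminormedAddCommGroup E] (v : ι → E) :
    ‖∑ i, v i‖ ^ 2 ≤ (Fintype.card ι : ℝ) * ∑ i, ‖v i‖ ^ 2 :=
  (pow_le_pow_left₀ (norm_nonneg _) (norm_sum_le _ _) 2).trans
    (by simpa using sq_sum_le_card_mul_sum_sq (s := Finset.univ) (f := fun i => ‖v i‖))

theorem norm_add_five_sq_le {E : Type*} [SeminormedAddCommGroup E] (a b c d e : E) :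
    ‖a + b + c + d + e‖ ^ 2 ≤ 5 * (‖a‖ ^ 2 + ‖b‖ ^ 2 + ‖c‖ ^ 2 + ‖d‖ ^ 2 + ‖e‖ ^ 2) := by
  simpa [Fin.sum_univ_five] using norm_sum_sq_le_card_mul ![a, b, c, d, e]

/- STATEMENT 7: one iteration of decentralized ADMM with randomized penalty matrices.
   Agent i holds an mᵢ-strongly convex function fᵢ with ‖∇fᵢ(x)−∇fᵢ(y)‖² ≤ Mᵢ‖x−y‖²,
   a full-row-rank matrix Aᵢ with largest singular value σmaxᵢ and smallest nonzero
   singular value σminᵢ; (x*, λ*) satisfies the KKT conditions.  At the iteration,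
   agent i uses positive diagonal matrices ρᵢ, Γᵢ with Aᵢᵀ ρᵢ Aᵢ + Γᵢ = Dᵢ·I; the new
   primal iterate x¹ᵢ satisfies the first-order optimality condition of the local ADMM
   subproblem and λ¹ = λᵏ − ζ(Σᵢ Aᵢ x¹ᵢ − c).  Under the stated parameter conditions on
   α, ρ⁰, Dᵢ, ζ, the G-norm contracts: ‖uᵏ − u*‖²_G ≥ (1+p)‖uᵏ⁺¹ − u*‖²_G with the
   explicit p > 0 below. -/
theorem stmt_7 (N q : ℕ) (hN : 0 < N) (n : Fin N → ℕ)
    (f : ∀ i, EuclideanSpace ℝ (Fin (n i)) → ℝ)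
    (g : ∀ i, EuclideanSpace ℝ (Fin (n i)) → EuclideanSpace ℝ (Fin (n i)))
    (hgrad : ∀ i x, HasGradientAt (f i) (g i x) x)
    (m M : Fin N → ℝ) (hm : ∀ i, 0 < m i)
    (hsc : ∀ i x y, m i * ‖x - y‖ ^ 2 ≤ ⟪x - y, g i x - g i y⟫_ℝ)
    (hsm : ∀ i x y, ‖g i x - g i y‖ ^ 2 ≤ M i * ‖x - y‖ ^ 2)
    (A : ∀ i, EuclideanSpace ℝ (Fin (n i)) →L[ℝ] EuclideanSpace ℝ (Fin q))
    (σmax σmin : Fin N → ℝ)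
    (hσmaxpos : ∀ i, 0 < σmax i) (hσmax : ∀ i, ‖A i‖ = σmax i)
    (hσminpos : ∀ i, 0 < σmin i)
    (hσmin : ∀ i (v : EuclideanSpace ℝ (Fin q)),
      σmin i * ‖v‖ ≤ ‖(ContinuousLinearMap.adjoint (A i)) v‖)
    (c : EuclideanSpace ℝ (Fin q))
    (xstar : ∀ i, EuclideanSpace ℝ (Fin (n i))) (lamstar : EuclideanSpace ℝ (Fin q))
    (hKKT1 : ∀ i, g i (xstar i) = (ContinuousLinearMap.adjoint (A i)) lamstar)
    (hKKT2 : ∑ i, A i (xstar i) = c)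
    (ρ : Fin N → Fin q → ℝ) (hρ : ∀ i l, 0 < ρ i l)
    (Γ : ∀ i, Fin (n i) → ℝ) (hΓ : ∀ i l, 0 < Γ i l)
    (D : Fin N → ℝ)
    (hD : ∀ i (x : EuclideanSpace ℝ (Fin (n i))),
      (ContinuousLinearMap.adjoint (A i)) (diagOp (ρ i) ((A i) x)) + diagOp (Γ i) x
        = D i • x)
    (ρmax ρbreve : Fin N → ℝ) (ρ0 : ℝ)
    (hρmax : ∀ i, IsGreatest (Set.range (ρ i)) (ρmax i))
    (hρbreve : ∀ i, IsGreatest (Set.range fun l => |ρ i l - ρ0|) (ρbreve i))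
    (α ζ : ℝ) (hα : 0 < α)
    (hαcond : ∀ i, α < 2 * m i /
      ((N : ℝ) * ρmax i ^ 2 * σmax i ^ 2 + ρbreve i ^ 2 * σmax i ^ 2))
    (hDcond : ∀ i, D i > max (ρmax i * σmax i ^ 2) ((N : ℝ) * σmax i ^ 2 / α))
    (hρ0 : ρ0 > (N : ℝ) / (2 * α))
    (hζpos : 0 < ζ) (hζ : ζ < 2 * ρ0 - (N : ℝ) / α)
    (xk x1 : ∀ i, EuclideanSpace ℝ (Fin (n i))) (lamk lam1 : EuclideanSpace ℝ (Fin q))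
    (hx1 : ∀ i, g i (x1 i) =
      (ContinuousLinearMap.adjoint (A i))
          (lamk - diagOp (ρ i)
            ((A i) (x1 i) + (∑ j ∈ Finset.univ.erase i, (A j) (xk j)) - c))
        + diagOp (Γ i) (xk i - x1 i))
    (hlam1 : lam1 = lamk - ζ • ((∑ i, (A i) (x1 i)) - c)) :
    let p : ℝ :=
      min (⨅ i : Fin N, min
          ((2 * m i - α * (N : ℝ) * ρmax i ^ 2 * σmax i ^ 2
              - α * ρbreve i ^ 2 * σmax i ^ 2) /
            (5 * M i / (ζ * (N : ℝ) * σmin i ^ 2) + D i))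
          ((D i - (N : ℝ) * σmax i ^ 2 / α) /
            (5 * D i ^ 2 / (ζ * (N : ℝ) * σmin i ^ 2) +
              (5 * σmax i ^ 2 / ζ) * ∑ j, ρmax j ^ 2 * σmax j ^ 2 / σmin j ^ 2)))
        ((2 * ρ0 / ζ - (N : ℝ) / (α * ζ) - 1) /
          (5 * ∑ i, (ρmax i ^ 2 / ζ ^ 2 + 1 / (N : ℝ)) * σmax i ^ 2 / σmin i ^ 2))
    0 < p ∧
      (∑ i, D i * ‖xk i - xstar i‖ ^ 2) + (1 / ζ) * ‖lamk - lamstar‖ ^ 2 ≥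
        (1 + p) * ((∑ i, D i * ‖x1 i - xstar i‖ ^ 2) + (1 / ζ) * ‖lam1 - lamstar‖ ^ 2) := by
  intro p
  have hN1 : (1 : ℝ) ≤ N := by exact_mod_cast hN
  have hN0 : (0 : ℝ) < N := by linarith
  have : Nonempty (Fin N) := ⟨⟨0, hN⟩⟩
  have hρmaxpos : ∀ i, 0 < ρmax i := fun i => by
    obtain ⟨l, hl⟩ := (hρmax i).1
    exact hl ▸ hρ i l
  have hρbr0 : ∀ i, 0 ≤ ρbreve i := fun i => by
    obtain ⟨l, hl⟩ := (hρbreve i).1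
    exact hl ▸ abs_nonneg _
  have hDpos : ∀ i, 0 < D i := fun i =>
    (mul_pos (hρmaxpos i) (pow_pos (hσmaxpos i) 2)).trans ((le_max_left _ _).trans_lt (hDcond i))
  have hMnonneg : ∀ i, 0 ≤ M i := fun i => by
    obtain ⟨x, hx⟩ : ∃ x, A i x ≠ 0 := by
      by_contra! h
      have : A i = 0 := ContinuousLinearMap.ext h
      have h' := hσmax i
      rw [this, norm_zero] at h'
      exact (hσmaxpos i).ne h'
    have hx0 : x ≠ 0 := fun h => hx (by simp [h])
    have h := (sq_nonneg _).trans (hsm i x 0)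
    rw [sub_zero] at h
    exact nonneg_of_mul_nonneg_left h (by positivity)
  have hA : ∀ i x, ‖A i x‖ ≤ σmax i * ‖x‖ := fun i x => hσmax i ▸ (A i).le_opNorm x
  have hAadj : ∀ i v, ‖(ContinuousLinearMap.adjoint (A i)) v‖ ≤ σmax i * ‖v‖ := fun i v => by
    have h := (ContinuousLinearMap.adjoint (A i)).le_opNorm v
    rwa [LinearIsometryEquiv.norm_map, hσmax i] at h
  have hρop : ∀ i v, ‖diagOp (ρ i) v‖ ≤ ρmax i * ‖v‖ := fun i =>
    norm_diagOp_le (hρmaxpos i).le fun l => by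
      rw [abs_of_pos (hρ i l)]
      exact (hρmax i).2 ⟨l, rfl⟩
  have hρbrop : ∀ i v, ‖diagOp (fun l => ρ i l - ρ0) v‖ ≤ ρbreve i * ‖v‖ := fun i =>
    norm_diagOp_le (hρbr0 i) fun l => (hρbreve i).2 ⟨l, rfl⟩
  -- errors, increments and residuals
  set e : ∀ i, EuclideanSpace ℝ (Fin (n i)) := fun i => x1 i - xstar i with he
  set y : ∀ i, EuclideanSpace ℝ (Fin (n i)) := fun i => xk i - x1 i with hy
  set w := lam1 - lamstar with hw
  set r := (∑ i, A i (x1 i)) - c with hr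
  set s := ∑ i, A i (y i) with hs
  have hr' : r = ∑ i, A i (e i) := by
    simp only [hr, he, map_sub, Finset.sum_sub_distrib, hKKT2]
  have hfoc : ∀ i, g i (x1 i) - g i (xstar i) =
      (ContinuousLinearMap.adjoint (A i)) (w + ζ • r - diagOp (ρ i) r - diagOp (ρ i) s)
        + D i • y i := fun i => by
    have h1 : (A i) (x1 i) + (∑ j ∈ Finset.univ.erase i, (A j) (xk j)) - c
        = r + s - A i (y i) := by
      have h := Finset.add_sum_erase Finset.univ (fun j => A j (xk j)) (Finset.mem_univ i)
      simp only [hs, hr, hy, map_sub, Finset.sum_sub_distrib, ← h]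
      abel
    have h2 : lamk = w + ζ • r + lamstar := by
      simp only [hw, hlam1]
      abel
    have hyi : xk i - x1 i = y i := rfl
    rw [hx1 i, hKKT1 i, h1, hyi, ← hD i (y i), h2]
    simp only [diagOp_add, diagOp_sub, map_add, map_sub]
    abel
  -- the terms of the descent estimate
  have hsS : ‖s‖ ^ 2 ≤ N * ∑ i, σmax i ^ 2 * ‖y i‖ ^ 2 := by
    have h := norm_sum_sq_le_card_mul fun i => A i (y i)
    rw [Fintype.card_fin] at h
    refine h.trans ?_
    gcongr with i
    rw [← mul_pow]
    exact pow_le_pow_left₀ (norm_nonneg _) (hA i _) 2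
  have hmono : ∀ i, (2 * m i - α * N * ρmax i ^ 2 * σmax i ^ 2 - α * ρbreve i ^ 2 * σmax i ^ 2)
        * ‖e i‖ ^ 2 - ‖s‖ ^ 2 / (α * N) - ‖r‖ ^ 2 / α
      ≤ 2 * ⟪A i (e i), w⟫_ℝ + 2 * (ζ - ρ0) * ⟪A i (e i), r⟫_ℝ + 2 * D i * ⟪e i, y i⟫_ℝ :=
    fun i => by
    have h1 := hsc i (x1 i) (xstar i)
    rw [hfoc i, inner_add_right, ContinuousLinearMap.adjoint_inner_right, inner_smul_right] at h1
    have h2 := neg_young_le_two_inner (mul_pos hα hN0) (hA i (e i)) (hρop i s)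
    have h3 := neg_young_le_two_inner hα (hA i (e i)) (hρbrop i r)
    rw [diagOp_sub_const] at h3
    simp only [inner_add_right, inner_sub_right, inner_smul_right] at h1 h3
    simp only [he] at h1 h2 h3 ⊢
    linarith
  have hdescent : ∑ i, (2 * m i - α * N * ρmax i ^ 2 * σmax i ^ 2 - α * ρbreve i ^ 2 * σmax i ^ 2)
        * ‖e i‖ ^ 2 + ∑ i, (D i - N * σmax i ^ 2 / α) * ‖y i‖ ^ 2
        + ζ * (2 * ρ0 / ζ - N / (α * ζ) - 1) * ‖r‖ ^ 2
      ≤ ((∑ i, D i * ‖xk i - xstar i‖ ^ 2) + (1 / ζ) * ‖lamk - lamstar‖ ^ 2)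
        - ((∑ i, D i * ‖e i‖ ^ 2) + (1 / ζ) * ‖w‖ ^ 2) := by
    have h1 := Finset.sum_le_sum fun i (_ : i ∈ Finset.univ) => hmono i
    simp only [Finset.sum_add_distrib, Finset.sum_sub_distrib, ← Finset.mul_sum,
      Finset.sum_const, Finset.card_univ, Fintype.card_fin, nsmul_eq_mul, ← sum_inner, ← hr'] at h1
    rw [real_inner_self_eq_norm_sq] at h1
    have h2 : ∀ i, D i * ‖xk i - xstar i‖ ^ 2
        = D i * ‖y i‖ ^ 2 + 2 * D i * ⟪e i, y i⟫_ℝ + D i * ‖e i‖ ^ 2 := fun i => by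
      have : xk i - xstar i = e i + y i := by simp only [he, hy]; abel
      rw [this, norm_add_sq_real]
      ring
    have h3 : lamk - lamstar = w + ζ • r := by
      simp only [hw, hlam1]
      abel
    have h4 : (1 / ζ) * ‖lamk - lamstar‖ ^ 2
        = (1 / ζ) * ‖w‖ ^ 2 + 2 * ⟪r, w⟫_ℝ + ζ * ‖r‖ ^ 2 := by
      rw [h3, norm_add_sq_real, inner_smul_right, norm_smul, mul_pow, Real.norm_eq_abs, sq_abs,
        real_inner_comm]
      field_simp
    have h5 : ∑ i, (D i - N * σmax i ^ 2 / α) * ‖y i‖ ^ 2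
        = ∑ i, D i * ‖y i‖ ^ 2 - N * (∑ i, σmax i ^ 2 * ‖y i‖ ^ 2) / α := by
      rw [Finset.mul_sum, Finset.sum_div, ← Finset.sum_sub_distrib]
      exact Finset.sum_congr rfl fun i _ => by ring
    have h6 : N * (‖s‖ ^ 2 / (α * N)) ≤ N * (∑ i, σmax i ^ 2 * ‖y i‖ ^ 2) / α := by
      rw [show N * (‖s‖ ^ 2 / (α * N)) = ‖s‖ ^ 2 / α by field_simp]
      gcongr
    have h7 : ζ * (2 * ρ0 / ζ - N / (α * ζ) - 1) * ‖r‖ ^ 2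
        = 2 * ρ0 * ‖r‖ ^ 2 - N * (‖r‖ ^ 2 / α) - ζ * ‖r‖ ^ 2 := by
      field_simp
    rw [Finset.sum_congr rfl fun i _ => h2 i, Finset.sum_add_distrib, Finset.sum_add_distrib,
      h4, h5, h7]
    linarith
  -- control of the dual error
  have hdual_i : ∀ i, (1 / ζ) * ‖w‖ ^ 2 / N ≤ 5 * M i / (ζ * N * σmin i ^ 2) * ‖e i‖ ^ 2
      + 5 * D i ^ 2 / (ζ * N * σmin i ^ 2) * ‖y i‖ ^ 2
      + ζ * (5 * ((ρmax i ^ 2 / ζ ^ 2 + 1 / N) * σmax i ^ 2 / σmin i ^ 2)) * ‖r‖ ^ 2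
      + 5 / (ζ * N) * (ρmax i ^ 2 * σmax i ^ 2 / σmin i ^ 2) * ‖s‖ ^ 2 := fun i => by
    have hσ := hσminpos i
    have h1 : (ContinuousLinearMap.adjoint (A i)) w = (g i (x1 i) - g i (xstar i))
        + -((ContinuousLinearMap.adjoint (A i)) (ζ • r))
        + (ContinuousLinearMap.adjoint (A i)) (diagOp (ρ i) r)
        + (ContinuousLinearMap.adjoint (A i)) (diagOp (ρ i) s) + -(D i • y i) := by
      rw [hfoc i]
      simp only [map_add, map_sub]
      abel
    have h2 := norm_add_five_sq_le (g i (x1 i) - g i (xstar i))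
      (-((ContinuousLinearMap.adjoint (A i)) (ζ • r)))
      ((ContinuousLinearMap.adjoint (A i)) (diagOp (ρ i) r))
      ((ContinuousLinearMap.adjoint (A i)) (diagOp (ρ i) s)) (-(D i • y i))
    rw [← h1, norm_neg, norm_neg, norm_smul, mul_pow, Real.norm_eq_abs, sq_abs] at h2
    have h3 := pow_le_pow_left₀ (by positivity) (hσmin i w) 2
    have h4 := hsm i (x1 i) (xstar i)
    have h5 := pow_le_pow_left₀ (norm_nonneg _) (hAadj i (ζ • r)) 2
    rw [norm_smul, Real.norm_eq_abs, mul_pow, mul_pow, sq_abs] at h5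
    have hAρ : ∀ v, ‖(ContinuousLinearMap.adjoint (A i)) (diagOp (ρ i) v)‖ ^ 2
        ≤ ρmax i ^ 2 * σmax i ^ 2 * ‖v‖ ^ 2 := fun v => by
      have h := (hAadj i (diagOp (ρ i) v)).trans
        (mul_le_mul_of_nonneg_left (hρop i v) (hσmaxpos i).le)
      exact (pow_le_pow_left₀ (norm_nonneg _) h 2).trans_eq (by ring)
    have h6 := hAρ r
    have h7 := hAρ s
    have h8 : ‖w‖ ^ 2 * σmin i ^ 2 ≤ 5 * (M i * ‖e i‖ ^ 2 + σmax i ^ 2 * (ζ ^ 2 * ‖r‖ ^ 2)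
        + N * ρmax i ^ 2 * σmax i ^ 2 * ‖r‖ ^ 2 + ρmax i ^ 2 * σmax i ^ 2 * ‖s‖ ^ 2
        + D i ^ 2 * ‖y i‖ ^ 2) := by
      have h9 : ρmax i ^ 2 * σmax i ^ 2 * ‖r‖ ^ 2 ≤ N * (ρmax i ^ 2 * σmax i ^ 2 * ‖r‖ ^ 2) :=
        le_mul_of_one_le_left (by positivity) hN1
      simp only [he]
      rw [mul_pow] at h3
      linarith
    calc (1 / ζ) * ‖w‖ ^ 2 / N = ‖w‖ ^ 2 * σmin i ^ 2 / (ζ * N * σmin i ^ 2) := by field_simp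
      _ ≤ _ := div_le_div_of_nonneg_right h8 (by positivity)
      _ = _ := by
        field_simp
        ring
  have hdual : (1 / ζ) * ‖w‖ ^ 2 ≤ ∑ i, 5 * M i / (ζ * N * σmin i ^ 2) * ‖e i‖ ^ 2
      + ∑ i, (5 * D i ^ 2 / (ζ * N * σmin i ^ 2)
        + (5 * σmax i ^ 2 / ζ) * ∑ j, ρmax j ^ 2 * σmax j ^ 2 / σmin j ^ 2) * ‖y i‖ ^ 2
      + ζ * (5 * ∑ i, (ρmax i ^ 2 / ζ ^ 2 + 1 / N) * σmax i ^ 2 / σmin i ^ 2) * ‖r‖ ^ 2 := by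
    have h1 := Finset.sum_le_sum fun i (_ : i ∈ Finset.univ) => hdual_i i
    simp only [Finset.sum_add_distrib, ← Finset.mul_sum, ← Finset.sum_mul,
      Finset.sum_const, Finset.card_univ, Fintype.card_fin, nsmul_eq_mul] at h1
    rw [mul_div_cancel₀ _ hN0.ne'] at h1
    set B := ∑ j, ρmax j ^ 2 * σmax j ^ 2 / σmin j ^ 2
    have hB : 0 ≤ B := Finset.sum_nonneg fun j _ => by positivity
    have h2 : 5 / (ζ * N) * B * ‖s‖ ^ 2 ≤ ∑ i, (5 * σmax i ^ 2 / ζ) * B * ‖y i‖ ^ 2 := by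
      have h3 : ∑ i, (5 * σmax i ^ 2 / ζ) * B * ‖y i‖ ^ 2
          = 5 / ζ * B * ∑ i, σmax i ^ 2 * ‖y i‖ ^ 2 := by
        rw [Finset.mul_sum]
        exact Finset.sum_congr rfl fun i _ => by ring
      rw [h3]
      refine (mul_le_mul_of_nonneg_left hsS (by positivity)).trans_eq ?_
      field_simp
    simp only [add_mul, Finset.sum_add_distrib] at h1 ⊢
    linarith
  have hα' : ∀ i,
      0 < 2 * m i - α * N * ρmax i ^ 2 * σmax i ^ 2 - α * ρbreve i ^ 2 * σmax i ^ 2 := fun i => by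
    have h1 := hρmaxpos i
    have h2 := hσmaxpos i
    have h := (lt_div_iff₀ (by positivity)).mp (hαcond i)
    linarith
  have hD' : ∀ i, 0 < D i - N * σmax i ^ 2 / α := fun i =>
    sub_pos.mpr ((le_max_right _ _).trans_lt (hDcond i))
  have hζ' : 0 < 2 * ρ0 / ζ - N / (α * ζ) - 1 := by
    have h : 2 * ρ0 / ζ - N / (α * ζ) - 1 = (2 * ρ0 - N / α - ζ) / ζ := by field_simp
    rw [h]
    exact div_pos (by linarith) hζpos
  have hden1 : ∀ i, 0 < 5 * M i / (ζ * N * σmin i ^ 2) + D i := fun i => by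
    have h1 := hMnonneg i
    have h2 := hDpos i
    positivity
  have hden2 : ∀ i, 0 < 5 * D i ^ 2 / (ζ * N * σmin i ^ 2)
      + (5 * σmax i ^ 2 / ζ) * ∑ j, ρmax j ^ 2 * σmax j ^ 2 / σmin j ^ 2 := fun i => by
    have h1 := hDpos i
    have h2 := hσminpos i
    have h3 : 0 ≤ ∑ j, ρmax j ^ 2 * σmax j ^ 2 / σmin j ^ 2 :=
      Finset.sum_nonneg fun j _ => by positivity
    positivity
  have hden3 : 0 < 5 * ∑ i, (ρmax i ^ 2 / ζ ^ 2 + 1 / (N : ℝ)) * σmax i ^ 2 / σmin i ^ 2 := by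
    refine mul_pos (by norm_num) (Finset.sum_pos (fun i _ => ?_) Finset.univ_nonempty)
    have h1 := hσmaxpos i
    have h2 := hσminpos i
    positivity
  have hp : 0 < p := by
    refine lt_min ?_ (div_pos hζ' hden3)
    obtain ⟨i, hi⟩ := exists_eq_ciInf_of_finite (f := fun i : Fin N => min
      ((2 * m i - α * (N : ℝ) * ρmax i ^ 2 * σmax i ^ 2 - α * ρbreve i ^ 2 * σmax i ^ 2) /
        (5 * M i / (ζ * (N : ℝ) * σmin i ^ 2) + D i))
      ((D i - (N : ℝ) * σmax i ^ 2 / α) /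
        (5 * D i ^ 2 / (ζ * (N : ℝ) * σmin i ^ 2) +
          (5 * σmax i ^ 2 / ζ) * ∑ j, ρmax j ^ 2 * σmax j ^ 2 / σmin j ^ 2)))
    rw [← hi]
    exact lt_min (div_pos (hα' i) (hden1 i)) (div_pos (hD' i) (hden2 i))
  have hpi := fun i => (min_le_left _ _ : p ≤ _).trans (ciInf_le (Set.finite_range _).bddBelow i)
  have hp1 : ∀ i, p * (5 * M i / (ζ * N * σmin i ^ 2) + D i)
      ≤ 2 * m i - α * N * ρmax i ^ 2 * σmax i ^ 2 - α * ρbreve i ^ 2 * σmax i ^ 2 :=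
    fun i => (le_div_iff₀ (hden1 i)).mp ((hpi i).trans (min_le_left _ _))
  have hp2 : ∀ i, p * (5 * D i ^ 2 / (ζ * N * σmin i ^ 2)
      + (5 * σmax i ^ 2 / ζ) * ∑ j, ρmax j ^ 2 * σmax j ^ 2 / σmin j ^ 2)
      ≤ D i - N * σmax i ^ 2 / α :=
    fun i => (le_div_iff₀ (hden2 i)).mp ((hpi i).trans (min_le_right _ _))
  have hp3 : p * (5 * ∑ i, (ρmax i ^ 2 / ζ ^ 2 + 1 / (N : ℝ)) * σmax i ^ 2 / σmin i ^ 2)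
      ≤ 2 * ρ0 / ζ - N / (α * ζ) - 1 :=
    (le_div_iff₀ hden3).mp (min_le_right _ _ : p ≤ _)
  clear_value p
  refine ⟨hp, ?_⟩
  have h1 := Finset.sum_le_sum fun i (_ : i ∈ Finset.univ) =>
    mul_le_mul_of_nonneg_right (hp1 i) (sq_nonneg ‖e i‖)
  have h2 := Finset.sum_le_sum fun i (_ : i ∈ Finset.univ) =>
    mul_le_mul_of_nonneg_right (hp2 i) (sq_nonneg ‖y i‖)
  have h3 := mul_le_mul_of_nonneg_right (mul_le_mul_of_nonneg_left hp3 hζpos.le) (sq_nonneg ‖r‖)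
  have h4 := mul_le_mul_of_nonneg_left hdual hp.le
  simp only [mul_assoc p, ← Finset.mul_sum] at h1 h2
  simp only [add_mul, Finset.sum_add_distrib] at h1
  change (1 + p) * ((∑ i, D i * ‖e i‖ ^ 2) + (1 / ζ) * ‖w‖ ^ 2) ≤ _
  linarith
end

section
/- Let f_1, …, f_N : ℝ^d → ℝ be convex differentiable functions with ‖∇f_i(x)‖² ≤ G² for all x and all i, and let x* be a minimizer of Σ_{i=1}^N f_i. Fix c > 0 and set η_k = 1/(c√k). Given initial points x_i^0 ∈ ℝ^d, define iterates by x_i^{k+1} = x̄^k − η_{k+1}∇f_i(x̄^k) for each i, where x̄^k = (1/N)Σ_{i=1}^N x_i^k. Then for every K ≥ 1, with x̃^{K−1} = (1/K)Σ_{k=0}^{K−1} x̄^k, one has Σ_{i=1}^N f_i(x̃^{K−1}) − Σ_{i=1}^N f_i(x*) ≤ (c√K · Σ_{i=1}^N ‖x_i^0 − x*‖² + N c^{-1}(log K + 2)√(K+1) · G²) / K. -/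
open scoped BigOperators

/-- First-order characterisation of convexity: the gradient gives a supporting hyperplane. -/
theorem ConvexOn.inner_gradient_le {E : Type*} [NormedAddCommGroup E] [InnerProductSpace ℝ E]
    [CompleteSpace E] {f : E → ℝ} {v x : E} (hf : ConvexOn ℝ Set.univ f)
    (hv : HasGradientAt f v x) (y : E) : inner ℝ v (y - x) ≤ f y - f x := by
  have hline : ConvexOn ℝ Set.univ (f ∘ AffineMap.lineMap (k := ℝ) x y) := by
    simpa using hf.comp_affineMap (AffineMap.lineMap (k := ℝ) x y)
  have hd : HasDerivAt (f ∘ AffineMap.lineMap (k := ℝ) x y) (inner ℝ v (y - x)) 0 := by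
    have hv' : HasFDerivAt f (InnerProductSpace.toDual ℝ E v)
        (AffineMap.lineMap (k := ℝ) x y 0) := by
      simpa using hv.hasFDerivAt
    simpa using hv'.comp_hasDerivAt (0 : ℝ) AffineMap.hasDerivAt_lineMap
  have h := hline.le_slope_of_hasDerivAt (Set.mem_univ 0) (Set.mem_univ 1) one_pos hd
  simpa [slope_def_field] using h

/-- Jensen's inequality for the squared distance to a point. -/
theorem card_mul_norm_mean_sub_sq_le {E : Type*} [NormedAddCommGroup E] [InnerProductSpace ℝ E]
    {N : ℕ} (hN : 0 < N) (x : Fin N → E) (z : E) :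
    N * ‖(N : ℝ)⁻¹ • ∑ j, x j - z‖ ^ 2 ≤ ∑ j, ‖x j - z‖ ^ 2 := by
  have hN' : (N : ℝ) ≠ 0 := by positivity
  set m := (N : ℝ)⁻¹ • ∑ j, x j with hm
  have hsum : ∑ j, (x j - m) = 0 := by
    rw [Finset.sum_sub_distrib, Finset.sum_const, Finset.card_univ, Fintype.card_fin,
      ← Nat.cast_smul_eq_nsmul ℝ, hm, smul_inv_smul₀ hN', sub_self]
  calc (N : ℝ) * ‖m - z‖ ^ 2 = ∑ j, (‖m - z‖ ^ 2 + 2 * inner ℝ (m - z) (x j - m)) := by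
        rw [Finset.sum_add_distrib, ← Finset.mul_sum, ← inner_sum, hsum]
        simp
    _ ≤ ∑ j, ‖x j - z‖ ^ 2 := by
        refine Finset.sum_le_sum fun j _ ↦ ?_
        have h := norm_add_sq_real (m - z) (x j - m)
        rw [show m - z + (x j - m) = x j - z by abel] at h
        nlinarith [sq_nonneg ‖x j - m‖]

/-- A gradient step from a point `y` on a convex function with bounded gradient. -/
theorem ConvexOn.norm_gradient_step_sub_sq_le {E : Type*} [NormedAddCommGroup E]
    [InnerProductSpace ℝ E] [CompleteSpace E] {f : E → ℝ} {v y : E}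
    (hf : ConvexOn ℝ Set.univ f) (hv : HasGradientAt f v y) {G η : ℝ} (hG : ‖v‖ ^ 2 ≤ G ^ 2)
    (hη : 0 ≤ η) (z : E) :
    ‖y - η • v - z‖ ^ 2 ≤ ‖y - z‖ ^ 2 - 2 * η * (f y - f z) + η ^ 2 * G ^ 2 := by
  have h := norm_sub_sq_real (y - z) (η • v)
  rw [show y - z - η • v = y - η • v - z by abel, inner_smul_right, norm_smul, mul_pow,
    Real.norm_eq_abs, sq_abs] at h
  have hsub := hf.inner_gradient_le hv z
  rw [← neg_sub y z, inner_neg_right, real_inner_comm] at hsub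
  nlinarith [mul_le_mul_of_nonneg_left hsub hη, mul_le_mul_of_nonneg_left hG (sq_nonneg η)]

theorem sum_range_inv_add_one_le_one_add_log (K : ℕ) :
    ∑ k ∈ Finset.range K, ((k : ℝ) + 1)⁻¹ ≤ 1 + Real.log K := by
  have h := harmonic_le_one_add_log K
  simpa [harmonic] using h

/- STATEMENT 11: decentralized gradient descent for consensus optimization (noiseless).
   f₁,…,f_N : ℝ^d → ℝ convex differentiable with ‖∇fᵢ(x)‖² ≤ G², x* a minimizer of
   Σᵢ fᵢ, step sizes η_k = 1/(c√k), updates xᵢ^{k+1} = x̄^k − η_{k+1}∇fᵢ(x̄^k) where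
   x̄^k = (1/N)Σᵢ xᵢ^k.  Then for every K ≥ 1, with x̃^{K−1} = (1/K)Σ_{k=0}^{K−1} x̄^k,
   Σᵢ fᵢ(x̃^{K−1}) − Σᵢ fᵢ(x*) ≤
     (c√K·Σᵢ‖xᵢ⁰−x*‖² + N c⁻¹(log K + 2)√(K+1)·G²)/K. -/
theorem stmt_11 (d N : ℕ) (hN : 0 < N)
    (f : Fin N → EuclideanSpace ℝ (Fin d) → ℝ)
    (g : Fin N → EuclideanSpace ℝ (Fin d) → EuclideanSpace ℝ (Fin d))
    (hconv : ∀ i, ConvexOn ℝ Set.univ (f i))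
    (hgrad : ∀ i x, HasGradientAt (f i) (g i x) x)
    (G : ℝ) (hG : ∀ i x, ‖g i x‖ ^ 2 ≤ G ^ 2)
    (xstar : EuclideanSpace ℝ (Fin d))
    (hstar : ∀ y, (∑ i, f i xstar) ≤ ∑ i, f i y)
    (c : ℝ) (hc : 0 < c)
    (x : ℕ → Fin N → EuclideanSpace ℝ (Fin d))
    (hupd : ∀ k i, x (k + 1) i =
      ((N : ℝ)⁻¹ • ∑ j, x k j)
        - (1 / (c * Real.sqrt (k + 1))) • g i ((N : ℝ)⁻¹ • ∑ j, x k j))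
    (K : ℕ) (hK : 1 ≤ K) :
    (∑ i, f i ((K : ℝ)⁻¹ • ∑ k ∈ Finset.range K, (N : ℝ)⁻¹ • ∑ j, x k j))
        - (∑ i, f i xstar) ≤
      (c * Real.sqrt K * (∑ i, ‖x 0 i - xstar‖ ^ 2)
          + (N : ℝ) * c⁻¹ * (Real.log K + 2) * Real.sqrt (K + 1) * G ^ 2) / K := by
  set m : ℕ → EuclideanSpace ℝ (Fin d) := fun k ↦ (N : ℝ)⁻¹ • ∑ j, x k j with hm
  set gap : ℕ → ℝ := fun k ↦ ∑ i, f i (m k) - ∑ i, f i xstar with hgap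
  set S : ℕ → ℝ := fun k ↦ ∑ i, ‖x k i - xstar‖ ^ 2 with hS
  have hKpos : (0 : ℝ) < K := by exact_mod_cast hK
  have hgap_nonneg (k : ℕ) : 0 ≤ gap k := sub_nonneg.2 (hstar _)
  have hstep (k : ℕ) : 2 * (1 / (c * √(k + 1))) * gap k ≤
      S k - S (k + 1) + N * G ^ 2 / c ^ 2 * ((k : ℝ) + 1)⁻¹ := by
    set η := 1 / (c * √((k : ℝ) + 1)) with hη
    have hη_sq : η ^ 2 = (c ^ 2)⁻¹ * ((k : ℝ) + 1)⁻¹ := by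
      rw [hη, div_pow, mul_pow, Real.sq_sqrt (by positivity), one_pow, one_div, mul_inv]
    have hnext : S (k + 1) ≤
        ∑ i, (‖m k - xstar‖ ^ 2 - 2 * η * (f i (m k) - f i xstar) + η ^ 2 * G ^ 2) := by
      refine Finset.sum_le_sum fun i _ ↦ ?_
      rw [hupd k i]
      exact (hconv i).norm_gradient_step_sub_sq_le (hgrad i _) (hG i _) (by positivity) _
    rw [Finset.sum_add_distrib, Finset.sum_sub_distrib, ← Finset.mul_sum,
      Finset.sum_sub_distrib] at hnext
    simp only [Finset.sum_const, Finset.card_univ, Fintype.card_fin, nsmul_eq_mul] at hnext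
    have hmean : N * ‖m k - xstar‖ ^ 2 ≤ S k := card_mul_norm_mean_sub_sq_le hN (x k) xstar
    have hrw : N * G ^ 2 / c ^ 2 * ((k : ℝ) + 1)⁻¹ = N * (η ^ 2 * G ^ 2) := by
      rw [hη_sq]; ring
    rw [hrw]
    linarith
  have hweight (k : ℕ) (hk : k ∈ Finset.range K) :
      2 * gap k ≤ c * √K * (2 * (1 / (c * √(k + 1))) * gap k) := by
    have hle : √((k : ℝ) + 1) ≤ √K :=
      Real.sqrt_le_sqrt (by exact_mod_cast Finset.mem_range.1 hk)
    have hpos : 0 < √((k : ℝ) + 1) := by positivity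
    have hone : 1 ≤ c * √K * (1 / (c * √((k : ℝ) + 1))) := by
      rw [mul_one_div, one_le_div (by positivity)]
      gcongr
    nlinarith [hgap_nonneg k]
  have hsum_gap : 2 * ∑ k ∈ Finset.range K, gap k ≤
      c * √K * (S 0 + N * G ^ 2 / c ^ 2 * (1 + Real.log K)) := by
    calc 2 * ∑ k ∈ Finset.range K, gap k
        ≤ ∑ k ∈ Finset.range K, c * √K *
            (S k - S (k + 1) + N * G ^ 2 / c ^ 2 * ((k : ℝ) + 1)⁻¹) := by
          rw [Finset.mul_sum]
          refine Finset.sum_le_sum fun k hk ↦ (hweight k hk).trans ?_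
          gcongr
          exact hstep k
      _ = c * √K * (S 0 - S K +
            N * G ^ 2 / c ^ 2 * ∑ k ∈ Finset.range K, ((k : ℝ) + 1)⁻¹) := by
          rw [← Finset.mul_sum, Finset.sum_add_distrib, Finset.sum_range_sub', ← Finset.mul_sum]
      _ ≤ _ := by
          have hSK : 0 ≤ S K := Finset.sum_nonneg fun i _ ↦ by positivity
          gcongr
          · linarith
          · exact sum_range_inv_add_one_le_one_add_log K
  have hjensen : (∑ i, f i ((K : ℝ)⁻¹ • ∑ k ∈ Finset.range K, m k)) - ∑ i, f i xstar ≤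
      (∑ k ∈ Finset.range K, gap k) / K := by
    have hi (i : Fin N) : f i ((K : ℝ)⁻¹ • ∑ k ∈ Finset.range K, m k) ≤
        ∑ k ∈ Finset.range K, (K : ℝ)⁻¹ * f i (m k) := by
      rw [Finset.smul_sum]
      exact (hconv i).map_sum_le (fun _ _ ↦ by positivity) (by simp [hKpos.ne'])
        (fun _ _ ↦ Set.mem_univ _)
    have hle := Finset.sum_le_sum fun i (_ : i ∈ Finset.univ) ↦ hi i
    simp only [← Finset.mul_sum] at hle
    rw [Finset.sum_comm] at hle
    rw [Finset.sum_sub_distrib, Finset.sum_const, Finset.card_range, nsmul_eq_mul, sub_div,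
      mul_div_cancel_left₀ _ hKpos.ne', div_eq_inv_mul]
    linarith
  refine hjensen.trans ?_
  gcongr
  have hS0 : 0 ≤ c * √K * S 0 :=
    mul_nonneg (by positivity) (Finset.sum_nonneg fun i _ ↦ by positivity)
  have hlog : 0 ≤ Real.log K := Real.log_natCast_nonneg K
  have hnoise : c * √K * (N * G ^ 2 / c ^ 2 * (1 + Real.log K)) ≤
      N * c⁻¹ * (Real.log K + 2) * √(K + 1) * G ^ 2 := by
    calc c * √K * (N * G ^ 2 / c ^ 2 * (1 + Real.log K))
        = N * c⁻¹ * (Real.log K + 1) * √K * G ^ 2 := by field_simp; ring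
      _ ≤ _ := by gcongr <;> linarith
  have hnoise_nonneg : 0 ≤ N * c⁻¹ * (Real.log K + 2) * √(K + 1) * G ^ 2 := by positivity
  change _ ≤ c * √K * S 0 + _
  linarith
end

section
/- Let f_1, …, f_N : ℝ^d → ℝ be convex differentiable functions, let x* be a minimizer of Σ_{i=1}^N f_i, let x_1, …, x_N ∈ ℝ^d with average x̄ = (1/N)Σ_{i=1}^N x_i, let η > 0, and suppose ‖∇f_i(x̄)‖ ≤ G for all i. Define x_i⁺ = x̄ − η∇f_i(x̄). Then 2η (Σ_{i=1}^N f_i(x̄) − Σ_{i=1}^N f_i(x*)) ≤ Σ_{i=1}^N (‖x_i − x*‖² − ‖x_i⁺ − x*‖²) + η² N G². -/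
open scoped BigOperators

/-- First-order characterization of convexity: a convex function lies above its tangent planes. -/
theorem ConvexOn.inner_gradient_le_sub {F : Type*} [NormedAddCommGroup F]
    [InnerProductSpace ℝ F] [CompleteSpace F] {s : Set F} {f : F → ℝ} {f' x y : F}
    (hf : ConvexOn ℝ s f) (hx : x ∈ s) (hy : y ∈ s) (hf' : HasGradientAt f f' x) :
    inner ℝ f' (y - x) ≤ f y - f x := by
  have hline : ConvexOn ℝ (AffineMap.lineMap x y ⁻¹' s) (f ∘ AffineMap.lineMap (k := ℝ) x y) :=
    hf.comp_affineMap _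
  have hderiv : HasDerivAt (f ∘ AffineMap.lineMap (k := ℝ) x y) (inner ℝ f' (y - x)) 0 := by
    have hfx : HasFDerivAt f (InnerProductSpace.toDual ℝ F f')
        (AffineMap.lineMap (k := ℝ) x y 0) := by
      simpa using hf'.hasFDerivAt
    simpa using hfx.comp_hasDerivAt (0 : ℝ) AffineMap.hasDerivAt_lineMap
  simpa [slope_def_field] using
    hline.le_slope_of_hasDerivAt (by simpa using hx) (by simpa using hy) zero_lt_one hderiv

/-- The squared distance from a point to the mean of a finite family is at most the mean of the
squared distances. -/
theorem card_mul_norm_mean_sub_sq_le_s12 {ι F : Type*} [Fintype ι] [NormedAddCommGroup F]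
    [InnerProductSpace ℝ F] (x : ι → F) (y : F) :
    (Fintype.card ι : ℝ) * ‖(Fintype.card ι : ℝ)⁻¹ • ∑ i, x i - y‖ ^ 2 ≤
      ∑ i, ‖x i - y‖ ^ 2 := by
  cases isEmpty_or_nonempty ι with
  | inl h => simp
  | inr h =>
    set m := (Fintype.card ι : ℝ)⁻¹ • ∑ i, x i with hm
    have hsum : ∑ i, (x i - m) = 0 := by
      rw [Finset.sum_sub_distrib, Finset.sum_const, Finset.card_univ, ← Nat.cast_smul_eq_nsmul ℝ,
        hm, smul_inv_smul₀ (by simp), sub_self]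
    have hexp (i : ι) :
        ‖x i - y‖ ^ 2 = ‖x i - m‖ ^ 2 + 2 * inner ℝ (x i - m) (m - y) + ‖m - y‖ ^ 2 := by
      rw [← norm_add_sq_real, sub_add_sub_cancel]
    have hnonneg : 0 ≤ ∑ i, ‖x i - m‖ ^ 2 := Finset.sum_nonneg fun i _ => sq_nonneg _
    simp only [hexp, Finset.sum_add_distrib, ← Finset.mul_sum, ← sum_inner, hsum,
      inner_zero_left, Finset.sum_const, Finset.card_univ, nsmul_eq_mul]
    linarith

/-- Progress of one gradient step on a convex function, measured against an arbitrary point. -/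
theorem ConvexOn.gradient_step_le {F : Type*} [NormedAddCommGroup F]
    [InnerProductSpace ℝ F] [CompleteSpace F] {s : Set F} {f : F → ℝ} {f' x y : F} {η G : ℝ}
    (hf : ConvexOn ℝ s f) (hx : x ∈ s) (hy : y ∈ s) (hf' : HasGradientAt f f' x)
    (hη : 0 ≤ η) (hG : ‖f'‖ ≤ G) :
    2 * η * (f x - f y) ≤ ‖x - y‖ ^ 2 - ‖x - η • f' - y‖ ^ 2 + η ^ 2 * G ^ 2 := by
  have htangent := hf.inner_gradient_le_sub hx hy hf'
  rw [← neg_sub x y, inner_neg_right, real_inner_comm] at htangent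
  have hexp : ‖x - η • f' - y‖ ^ 2 =
      ‖x - y‖ ^ 2 - 2 * (η * inner ℝ (x - y) f') + η ^ 2 * ‖f'‖ ^ 2 := by
    rw [sub_right_comm, norm_sub_sq_real, inner_smul_right, norm_smul, mul_pow, Real.norm_eq_abs,
      sq_abs]
  have hnorm : η ^ 2 * ‖f'‖ ^ 2 ≤ η ^ 2 * G ^ 2 := by gcongr
  have hdescent : η * (f x - f y) ≤ η * inner ℝ (x - y) f' :=
    mul_le_mul_of_nonneg_left (by linarith) hη
  linarith

/- STATEMENT 12: per-iteration progress inequality for decentralized GD on a consensus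
   problem.  f₁,…,f_N convex differentiable, x* a minimizer of Σᵢ fᵢ, x̄ the average of
   the current iterates x₁,…,x_N, η > 0, ‖∇fᵢ(x̄)‖ ≤ G, xᵢ⁺ = x̄ − η∇fᵢ(x̄).  Then
   2η(Σᵢ fᵢ(x̄) − Σᵢ fᵢ(x*)) ≤ Σᵢ(‖xᵢ−x*‖² − ‖xᵢ⁺−x*‖²) + η²NG². -/
theorem stmt_12 (d N : ℕ) (hN : 0 < N)
    (f : Fin N → EuclideanSpace ℝ (Fin d) → ℝ)
    (g : Fin N → EuclideanSpace ℝ (Fin d) → EuclideanSpace ℝ (Fin d))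
    (hconv : ∀ i, ConvexOn ℝ Set.univ (f i))
    (hgrad : ∀ i x, HasGradientAt (f i) (g i x) x)
    (xstar : EuclideanSpace ℝ (Fin d))
    (hstar : ∀ y, (∑ i, f i xstar) ≤ ∑ i, f i y)
    (x : Fin N → EuclideanSpace ℝ (Fin d))
    (xbar : EuclideanSpace ℝ (Fin d)) (hxbar : xbar = (N : ℝ)⁻¹ • ∑ i, x i)
    (η : ℝ) (hη : 0 < η)
    (G : ℝ) (hG : ∀ i, ‖g i xbar‖ ≤ G) :
    2 * η * ((∑ i, f i xbar) - ∑ i, f i xstar) ≤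
      (∑ i, (‖x i - xstar‖ ^ 2 - ‖xbar - η • g i xbar - xstar‖ ^ 2))
        + η ^ 2 * N * G ^ 2 := by
  have hstep : ∑ i, 2 * η * (f i xbar - f i xstar) ≤
      ∑ i, (‖xbar - xstar‖ ^ 2 - ‖xbar - η • g i xbar - xstar‖ ^ 2 + η ^ 2 * G ^ 2) :=
    Finset.sum_le_sum fun i _ =>
      (hconv i).gradient_step_le (Set.mem_univ _) (Set.mem_univ _) (hgrad i xbar) hη.le (hG i)
  have hmean := card_mul_norm_mean_sub_sq_le_s12 x xstar
  rw [Fintype.card_fin, ← hxbar] at hmean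
  simp only [← Finset.mul_sum, Finset.sum_add_distrib, Finset.sum_sub_distrib, Finset.sum_const,
    Finset.card_univ, Fintype.card_fin, nsmul_eq_mul] at hstep ⊢
  linarith
end

section
/- Let f : ℝ^d → ℝ be differentiable with coordinate-Lipschitz gradient: for every coordinate l ∈ {1, …, d}, every x ∈ ℝ^d and every t ∈ ℝ, |∇f(x + t e_l)[l] − ∇f(x)[l]| ≤ M̂ |t|, where M̂ > 0 and e_l is the l-th standard basis vector. Then the average over coordinates of one exact coordinate-descent step with step size 1/M̂ satisfies (1/d) Σ_{l=1}^{d} f(x − (1/M̂)·∇f(x)[l]·e_l) ≤ f(x) − ‖∇f(x)‖² / (2 d M̂). -/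
open scoped BigOperators

/-- One-dimensional descent lemma on `[0, 1]`. -/
theorem le_add_deriv_add_half_of_abs_deriv_sub_le {φ φ' : ℝ → ℝ} {K : ℝ}
    (hφ : ∀ s, HasDerivAt φ (φ' s) s) (hK : ∀ s, 0 ≤ s → |φ' s - φ' 0| ≤ K * s) :
    φ 1 ≤ φ 0 + φ' 0 + K / 2 := by
  have hψ : ∀ s, HasDerivAt (fun s => φ' 0 * s + K / 2 * s ^ 2 - φ s)
      (φ' 0 + K * s - φ' s) s := by
    intro s
    have h := (((hasDerivAt_id s).const_mul (φ' 0)).add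
      (((hasDerivAt_id s).pow 2).const_mul (K / 2))).sub (hφ s)
    refine h.congr_deriv ?_
    simp
    ring
  have hmono : MonotoneOn (fun s => φ' 0 * s + K / 2 * s ^ 2 - φ s) (Set.Ici 0) := by
    refine monotoneOn_of_deriv_nonneg (convex_Ici 0)
      (fun s _ => (hψ s).continuousAt.continuousWithinAt)
      (fun s _ => (hψ s).differentiableAt.differentiableWithinAt) fun s hs => ?_
    rw [(hψ s).deriv]
    linarith [(abs_le.mp (hK s (interior_subset hs))).2]
  have h01 := hmono (Set.mem_Ici.mpr le_rfl) (Set.mem_Ici.mpr zero_le_one) zero_le_one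
  norm_num at h01
  linarith

/-- A coordinate step of size `M⁻¹` decreases `f` by at least `(g x l) ^ 2 / (2 * M)`. -/
theorem coordinate_step_le {ι : Type*} [Fintype ι] [DecidableEq ι]
    {f : EuclideanSpace ℝ ι → ℝ} {g : EuclideanSpace ℝ ι → EuclideanSpace ℝ ι}
    (hgrad : ∀ x, HasGradientAt f (g x) x) {M : ℝ} (hM : 0 < M) (l : ι)
    (x : EuclideanSpace ℝ ι)
    (hcoord : ∀ t : ℝ, |g (x + t • EuclideanSpace.single l (1 : ℝ)) l - g x l| ≤ M * |t|) :
    f (x - (M⁻¹ * g x l) • EuclideanSpace.single l (1 : ℝ)) ≤ f x - g x l ^ 2 / (2 * M) := by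
  set e := EuclideanSpace.single l (1 : ℝ) with he
  set c := M⁻¹ * g x l with hc
  have hφ : ∀ s : ℝ, HasDerivAt (fun s : ℝ => f (x + (s * -c) • e))
      (-c * g (x + (s * -c) • e) l) s := by
    intro s
    have hline : HasDerivAt (fun s : ℝ => x + (s * -c) • e) (-c • e) s := by
      simpa using ((((hasDerivAt_id s).mul_const (-c)).smul_const e).const_add x)
    have h := (hgrad (x + (s * -c) • e)).hasFDerivAt.comp_hasDerivAt s hline
    refine h.congr_deriv ?_
    rw [InnerProductSpace.toDual_apply_apply, inner_smul_right, he,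
      EuclideanSpace.inner_single_right]
    simp
  have hK : ∀ s : ℝ, 0 ≤ s →
      |-c * g (x + (s * -c) • e) l - -c * g (x + ((0 : ℝ) * -c) • e) l| ≤ M * c ^ 2 * s := by
    intro s hs
    have h := mul_le_mul_of_nonneg_left (hcoord (s * -c)) (abs_nonneg (-c))
    rw [zero_mul, zero_smul, add_zero, ← mul_sub, abs_mul]
    refine h.trans_eq ?_
    rw [abs_mul, abs_of_nonneg hs, abs_neg, ← sq_abs c]
    ring
  have h := le_add_deriv_add_half_of_abs_deriv_sub_le hφ hK
  simp only [one_mul, zero_mul, zero_smul, add_zero, neg_smul, ← sub_eq_add_neg] at h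
  refine h.trans_eq ?_
  rw [hc]
  field_simp
  ring

/- STATEMENT 15: f : ℝ^d → ℝ differentiable with coordinate-Lipschitz gradient
   (|∇f(x + t·e_l)[l] − ∇f(x)[l]| ≤ M̂|t| for all coordinates l, points x and t ∈ ℝ).
   Then the average over coordinates of an exact coordinate-descent step of size 1/M̂
   satisfies (1/d) Σ_l f(x − (1/M̂)∇f(x)[l] e_l) ≤ f(x) − ‖∇f(x)‖²/(2dM̂). -/
theorem stmt_15 (d : ℕ) (hd : 0 < d)
    (f : EuclideanSpace ℝ (Fin d) → ℝ)
    (g : EuclideanSpace ℝ (Fin d) → EuclideanSpace ℝ (Fin d))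
    (hgrad : ∀ x, HasGradientAt f (g x) x)
    (Mhat : ℝ) (hM : 0 < Mhat)
    (hcoord : ∀ (l : Fin d) (x : EuclideanSpace ℝ (Fin d)) (t : ℝ),
      |g (x + t • EuclideanSpace.single l (1 : ℝ)) l - g x l| ≤ Mhat * |t|)
    (x : EuclideanSpace ℝ (Fin d)) :
    (d : ℝ)⁻¹ * ∑ l, f (x - (Mhat⁻¹ * g x l) • EuclideanSpace.single l (1 : ℝ)) ≤
      f x - ‖g x‖ ^ 2 / (2 * d * Mhat) := by
  have hd' : (0 : ℝ) < d := Nat.cast_pos.mpr hd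
  calc (d : ℝ)⁻¹ * ∑ l, f (x - (Mhat⁻¹ * g x l) • EuclideanSpace.single l (1 : ℝ))
      ≤ (d : ℝ)⁻¹ * ∑ l, (f x - g x l ^ 2 / (2 * Mhat)) := by
        gcongr with l
        exact coordinate_step_le hgrad hM l x (hcoord l x)
    _ = f x - ‖g x‖ ^ 2 / (2 * d * Mhat) := by
        rw [EuclideanSpace.real_norm_sq_eq, Finset.sum_sub_distrib, ← Finset.sum_div]
        simp only [Finset.sum_const, Finset.card_univ, Fintype.card_fin, nsmul_eq_mul]
        field_simp
end
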